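/- arXiv:1908.00039 — 12 statements merged into one kernel-verified Lean document; each statement's English description precedes it below -/
import Mathlib

section
/- For all natural numbers a, b ≥ 0, the join of two simplices satisfies J(e_a, e_b) = e_{a+b+1}. -/
theorem stmt_0 (R : Type*) [CommRing R] (C : R → R)
    (hC : ∀ x y : R, C (x + y) = C x + C y)
    (e : ℕ → R) (he0 : e 0 = 1) (heS : ∀ n : ℕ, e (n + 1) = C (e n))
    (D : R) (hD : D = e 1 * e 1 - e 2)
    (J : R → R → R)
    (hJ : ∀ U V : R, J U V = U * C V + C U * V - e 1 * U * V)
    (hCP : ∀ U V : R, C U * C V = C (J U V) + D * U * V) :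
    ∀ a b : ℕ, J (e a) (e b) = e (a + b + 1) := by
  have h1 : C 1 = e 1 := by rw [← he0, ← heS]
  have hrec : ∀ a, e (a + 1) * e 1 = e (a + 2) + D * e a := by
    intro a
    have hj : J (e a) 1 = e (a + 1) := by
      rw [hJ, h1, ← heS]; ring
    have h := hCP (e a) 1
    rw [hj, h1, ← heS, ← heS] at h
    rw [h]; ring
  intro a b
  induction a with
  | zero =>
    rw [hJ, he0, h1, ← heS, Nat.zero_add]; ring
  | succ a ih =>
    have h := hCP (e a) (e b)
    rw [ih, ← heS, ← heS, ← heS] at h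
    have h2 := hrec a
    rw [hJ, ← heS, ← heS]
    have e3 : a + 1 + b + 1 = a + b + 1 + 1 := by omega
    rw [e3]
    linear_combination h - e b * h2
end

section
/- For all natural numbers a, b ≥ 1, the product of two simplices satisfies e_a · e_b = e_{a+b} + D · e_{a−1} · e_{b−1}. -/
theorem stmt_1 (R : Type*) [CommRing R] (C : R → R)
    (hC : ∀ x y : R, C (x + y) = C x + C y)
    (e : ℕ → R) (he0 : e 0 = 1) (heS : ∀ n : ℕ, e (n + 1) = C (e n))
    (D : R) (hD : D = e 1 * e 1 - e 2)
    (J : R → R → R)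
    (hJ : ∀ U V : R, J U V = U * C V + C U * V - e 1 * U * V)
    (hCP : ∀ U V : R, C U * C V = C (J U V) + D * U * V) :
    ∀ a b : ℕ, 1 ≤ a → 1 ≤ b →
      e a * e b = e (a + b) + D * e (a - 1) * e (b - 1) := by
  have h1 : C 1 = e 1 := by rw [← he0, ← heS]
  have key : ∀ m n : ℕ, J (e m) (e n) = e (m + n + 1) → 
      e (m + 1) * e (n + 1) = e (m + n + 2) + D * e m * e n := by
    intro m n h
    rw [heS m, heS n, hCP, h, ← heS]
  have J0 : ∀ n : ℕ, J (e 0) (e n) = e (0 + n + 1) := by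
    intro n
    rw [hJ, ← heS, ← heS, he0, Nat.zero_add]
    ring
  have Jc : ∀ U V : R, J U V = J V U := by
    intro U V
    rw [hJ, hJ]
    ring
  have P : ∀ m n : ℕ, J (e m) (e n) = e (m + n + 1) := by
    intro m
    induction m with
    | zero => exact J0
    | succ p ihp =>
      intro n
      induction n with
      | zero =>
        rw [Jc, J0]
        congr 1
        omega
      | succ q ihq =>
        have k1 := key p (q + 1) (ihp (q + 1))
        have k2 := key (p + 1) q ihq
        have k3 := key p q (ihp q)
        have k4 := key 0 (p + q + 1) (J0 _)
        have k5 := ihp q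
        rw [hJ, ← heS, ← heS] at k5
        rw [hJ, ← heS, ← heS]
        rw [show p + (q + 1) + 2 = p + q + 3 by omega] at k1
        rw [show p + 1 + q + 2 = p + q + 3 by omega] at k2
        rw [show 0 + (p + q + 1) + 2 = p + q + 3 by omega, he0] at k4
        rw [show p + 1 + (q + 1) + 1 = p + q + 3 by omega]
        simp only [Nat.zero_add, Nat.add_assoc, Nat.reduceAdd] at *
        linear_combination k1 + k2 - e 1 * k3 - k4 + D * k5
  intro a b ha hb
  obtain ⟨m, rfl⟩ := Nat.exists_eq_add_of_le' ha
  obtain ⟨n, rfl⟩ := Nat.exists_eq_add_of_le' hb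
  rw [key m n (P m n), show m + 1 + (n + 1) = m + n + 2 by omega]
  simp
end

section
/- For all natural numbers a ≥ 1 and b ≥ 0, the join of two simplices satisfies J(e_a, e_b) = e_a · e_{b+1} − D · e_{a−1} · e_b. -/
theorem stmt_2 (R : Type*) [CommRing R] (C : R → R)
    (hC : ∀ x y : R, C (x + y) = C x + C y)
    (e : ℕ → R) (he0 : e 0 = 1) (heS : ∀ n : ℕ, e (n + 1) = C (e n))
    (D : R) (hD : D = e 1 * e 1 - e 2)
    (J : R → R → R)
    (hJ : ∀ U V : R, J U V = U * C V + C U * V - e 1 * U * V)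
    (hCP : ∀ U V : R, C U * C V = C (J U V) + D * U * V) :
    ∀ a b : ℕ, 1 ≤ a →
      J (e a) (e b) = e a * e (b + 1) - D * e (a - 1) * e b := by
  intro a b ha
  obtain ⟨k, rfl⟩ : ∃ k, a = k + 1 := ⟨a - 1, by omega⟩
  have h1 : C 1 = e 1 := by rw [← he0, ← heS 0]
  have h := hCP 1 (e k)
  have hj : J 1 (e k) = e (k + 1) := by
    rw [hJ, h1, ← heS]; ring
  rw [hj, h1, ← heS, ← heS] at h
  rw [hJ, ← heS, ← heS, Nat.add_sub_cancel]
  linear_combination (-e b) * h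
end

section
/- For every natural number a ≥ 1 and every U ∈ R, one has e_a · C(U) = C^{a+1}(U) + D · e_{a−1} · U, where C^{a+1} denotes the (a+1)-fold iterate of the map C. -/
theorem stmt_3 (R : Type*) [CommRing R] (C : R → R)
    (hC : ∀ x y : R, C (x + y) = C x + C y)
    (e : ℕ → R) (he0 : e 0 = 1) (heS : ∀ n : ℕ, e (n + 1) = C (e n))
    (D : R) (hD : D = e 1 * e 1 - e 2)
    (J : R → R → R)
    (hJ : ∀ U V : R, J U V = U * C V + C U * V - e 1 * U * V)
    (hCP : ∀ U V : R, C U * C V = C (J U V) + D * U * V) :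
    ∀ (a : ℕ) (U : R), 1 ≤ a →
      e a * C U = C^[a + 1] U + D * e (a - 1) * U := by
  have h1 : ∀ U : R, e 1 * C U = C (C U) + D * U := by
    intro U
    have h := hCP 1 U
    have hj : J 1 U = C U := by
      rw [hJ, heS 0, he0]; ring
    rw [hj] at h
    rw [heS 0, he0, h]; ring
  intro a U ha
  induction a, ha using Nat.le_induction with
  | base => simpa [he0] using h1 U
  | succ n hn ih =>
    obtain ⟨m, rfl⟩ : ∃ m, n = m + 1 := ⟨n - 1, by omega⟩
    simp only [Nat.add_sub_cancel] at ih ⊢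
    have h2 := h1 (e m)
    rw [← heS, ← heS] at h2
    have hj : J (e (m + 1)) U = C^[m + 1 + 1] U := by
      rw [hJ, ← heS]
      linear_combination ih - U * h2
    rw [heS (m + 1), hCP, hj, Function.iterate_succ_apply' C (m + 1 + 1)]
end

section
/- For every natural number a ≥ 1 and every U ∈ R, one has J(e_{a−1}, U) = C^a(U), where C^a denotes the a-fold iterate of the map C. -/
theorem stmt_4 (R : Type*) [CommRing R] (C : R → R)
    (hC : ∀ x y : R, C (x + y) = C x + C y)
    (e : ℕ → R) (he0 : e 0 = 1) (heS : ∀ n : ℕ, e (n + 1) = C (e n))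
    (D : R) (hD : D = e 1 * e 1 - e 2)
    (J : R → R → R)
    (hJ : ∀ U V : R, J U V = U * C V + C U * V - e 1 * U * V)
    (hCP : ∀ U V : R, C U * C V = C (J U V) + D * U * V) :
    ∀ (a : ℕ) (U : R), 1 ≤ a → J (e (a - 1)) U = C^[a] U := by
  have h1 : C 1 = e 1 := by rw [← he0, ← heS]
  have hJ1 : ∀ U, J U 1 = C U := by
    intro U
    rw [hJ, h1]; ring
  have hstep : ∀ U V, J (C U) V = C (J U V) := by
    intro U V
    have h2 := hCP U 1
    rw [hJ1, h1] at h2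
    rw [hJ (C U) V]
    linear_combination hCP U V - V * h2
  have key : ∀ (n : ℕ) (U : R), J (e n) U = C^[n + 1] U := by
    intro n
    induction n with
    | zero => intro U; rw [he0, hJ, h1]; simp
    | succ k ih => intro U; rw [heS, hstep, ih, ← Function.iterate_succ_apply' C]
  intro a U ha
  obtain ⟨n, rfl⟩ := Nat.exists_eq_add_of_le' ha
  exact key n U
end

section
/- For all natural numbers a, c ≥ 1 and b, d ≥ 0, one has (D^b · e_a) · (D^d · e_c) = D^{b+d} · e_{a+c} + D^{b+d+1} · e_{a−1} · e_{c−1}. -/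
theorem stmt_5 (R : Type*) [CommRing R] (C : R → R)
    (hC : ∀ x y : R, C (x + y) = C x + C y)
    (e : ℕ → R) (he0 : e 0 = 1) (heS : ∀ n : ℕ, e (n + 1) = C (e n))
    (D : R) (hD : D = e 1 * e 1 - e 2)
    (J : R → R → R)
    (hJ : ∀ U V : R, J U V = U * C V + C U * V - e 1 * U * V)
    (hCP : ∀ U V : R, C U * C V = C (J U V) + D * U * V) :
    ∀ a b c d : ℕ, 1 ≤ a → 1 ≤ c →
      (D ^ b * e a) * (D ^ d * e c)
        = D ^ (b + d) * e (a + c) + D ^ (b + d + 1) * e (a - 1) * e (c - 1) := by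
  have key : ∀ a c : ℕ, J (e a) (e c) = e (a + c + 1) := by
    have prod : ∀ a c : ℕ, J (e a) (e c) = e (a + c + 1) →
        e (a + 1) * e (c + 1) = e (a + c + 2) + D * e a * e c := by
      intro a c h
      have := hCP (e a) (e c)
      rw [h, ← heS, ← heS, ← heS] at this
      exact this
    have h0 : ∀ c : ℕ, J (e 0) (e c) = e (0 + c + 1) := by
      intro c
      rw [hJ, ← heS, ← heS, he0, Nat.zero_add]
      ring
    intro a
    induction a with
    | zero => exact h0
    | succ a iha =>
      intro c
      induction c with
      | zero =>
        rw [hJ, ← heS, ← heS, he0]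
        simp only [Nat.zero_add, Nat.add_zero]
        ring
      | succ c ihc =>
        have p1 := prod a (c + 1) (iha (c + 1))
        have p2 := prod (a + 1) c ihc
        have p3 := prod a c (iha c)
        have p4 := prod 0 (a + c + 1) (h0 _)
        have p5 := iha c
        rw [hJ, ← heS, ← heS] at p5
        rw [hJ, ← heS, ← heS]
        rw [he0] at p4
        rw [show a + (c + 1) + 2 = a + c + 3 by omega] at p1
        rw [show a + 1 + c + 2 = a + c + 3 by omega] at p2
        rw [show 0 + (a + c + 1) + 2 = a + c + 3 by omega, Nat.zero_add,
          show a + c + 1 + 1 = a + c + 2 by omega] at p4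
        rw [show a + 1 + (c + 1) + 1 = a + c + 3 by omega]
        linear_combination p1 + p2 - e 1 * p3 - p4 + D * p5
  intro a b c d ha hc
  obtain ⟨a, rfl⟩ := Nat.exists_eq_add_of_le' ha
  obtain ⟨c, rfl⟩ := Nat.exists_eq_add_of_le' hc
  have h := hCP (e a) (e c)
  rw [key, ← heS, ← heS, ← heS] at h
  rw [show a + 1 + (c + 1) = a + c + 1 + 1 by omega, Nat.add_sub_cancel, Nat.add_sub_cancel]
  linear_combination D ^ (b + d) * h
end

section
/- One has the identity (C(D) − D·e_1)^2 = 2·C(D·C(D)) − C(D·D·e_1) + D·D·D − 2·D·C(C(D)) − 2·D·D·D + D·D·e_2 + D·D·D. (In the paper's notation this is the expansion of (⟨CD⟩−⟨DC⟩)^2 as 2⟨CDCD⟩ − ⟨CDDC⟩ + ⟨DDD⟩ − 2⟨DCCD⟩ − 2⟨DDD⟩ + ⟨DDCC⟩ + ⟨DDD⟩.) -/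
theorem stmt_7 (R : Type*) [CommRing R] (C : R → R)
    (hC : ∀ x y : R, C (x + y) = C x + C y)
    (e : ℕ → R) (he0 : e 0 = 1) (heS : ∀ n : ℕ, e (n + 1) = C (e n))
    (D : R) (hD : D = e 1 * e 1 - e 2)
    (J : R → R → R)
    (hJ : ∀ U V : R, J U V = U * C V + C U * V - e 1 * U * V)
    (hCP : ∀ U V : R, C U * C V = C (J U V) + D * U * V) :
    (C D - D * e 1) ^ 2
      = 2 * C (D * C D) - C (D * D * e 1) + D * D * D
        - 2 * (D * C (C D)) - 2 * (D * D * D) + D * D * e 2 + D * D * D := by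
  have h1 : C 1 = e 1 := by rw [← he0, ← heS]
  have hDD := hCP D D
  have hD1 := hCP D 1
  have e1 : J D 1 = C D := by rw [hJ, h1]; ring
  rw [e1, h1] at hD1
  have e2 : J D D + D * D * e 1 = D * C D + D * C D := by rw [hJ]; ring
  have h3 := congrArg C e2
  rw [hC, hC] at h3
  linear_combination hDD - 2 * D * hD1 + h3 - D * D * hD
end

section
/- Set x = C(D) − D·e_1, y = C(D·C(D)) − D·C(C(D)) − C(D·D·e_1) + D·D·e_2, and z = C(D·D·e_1) − D·D·e_2. Then x·x = 2·y + z. (In the paper's notation this is the rank-basis product formula {00 00}·{00 00} = 2·{00 00 00} + {00 11}.) -/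
theorem stmt_8 (R : Type*) [CommRing R] (C : R → R)
    (hC : ∀ x y : R, C (x + y) = C x + C y)
    (e : ℕ → R) (he0 : e 0 = 1) (heS : ∀ n : ℕ, e (n + 1) = C (e n))
    (D : R) (hD : D = e 1 * e 1 - e 2)
    (J : R → R → R)
    (hJ : ∀ U V : R, J U V = U * C V + C U * V - e 1 * U * V)
    (hCP : ∀ U V : R, C U * C V = C (J U V) + D * U * V) :
    ∀ x y z : R,
      x = C D - D * e 1 →
      y = C (D * C D) - D * C (C D) - C (D * D * e 1) + D * D * e 2 →
      z = C (D * D * e 1) - D * D * e 2 →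
      x * x = 2 * y + z := by
  intro x y z hx hy hz
  have h1 : e 1 = C 1 := by rw [← he0]; exact heS 0
  have hneg : ∀ a b : R, C (a - b) = C a - C b := by
    intro a b
    have h := hC (a - b) b
    rw [sub_add_cancel] at h
    rw [h]; ring
  have hA : e 1 * C D = C (C D) + D * D := by
    have h := hCP 1 D
    have hj : J 1 D = C D := by rw [hJ, ← h1]; ring
    rw [hj, ← h1] at h
    rw [h]; ring
  have hB : C D * C D = C (D * C D) + C (D * C D) - C (D * D * e 1) + D * D * D := by
    have hj : J D D = D * C D + D * C D - D * D * e 1 := by rw [hJ]; ring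
    rw [hCP D D, hj, hneg, hC]
  subst hx hy hz
  linear_combination hB - 2 * D * hA - D * D * hD
end

section
/- Define the quasi-simplices q : ℕ → R by q_0 = 1 and q_n = e_n − e_{n−1} for n ≥ 1. Then for all natural numbers a, b ≥ 1 one has the quasi-simplex product formula q_a · q_b = q_{a+b} − q_{a+b−1} + D · q_{a−1} · q_{b−1}. -/
theorem stmt_9 (R : Type*) [CommRing R] (C : R → R)
    (hC : ∀ x y : R, C (x + y) = C x + C y)
    (e : ℕ → R) (he0 : e 0 = 1) (heS : ∀ n : ℕ, e (n + 1) = C (e n))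
    (D : R) (hD : D = e 1 * e 1 - e 2)
    (J : R → R → R)
    (hJ : ∀ U V : R, J U V = U * C V + C U * V - e 1 * U * V)
    (hCP : ∀ U V : R, C U * C V = C (J U V) + D * U * V) :
    ∀ q : ℕ → R, q 0 = 1 → (∀ n : ℕ, 1 ≤ n → q n = e n - e (n - 1)) →
      ∀ a b : ℕ, 1 ≤ a → 1 ≤ b →
        q a * q b = q (a + b) - q (a + b - 1) + D * q (a - 1) * q (b - 1) := by
  have P : ∀ n a b : ℕ, a + b = n → J (e a) (e b) = e (a + b + 1) →
      e (a + 1) * e (b + 1) = e (a + b + 2) + D * e a * e b := by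
    intro n a b _ h
    rw [heS a, heS b, hCP, h, heS (a + b + 1)]
  have S0 : ∀ b, J (e 0) (e b) = e (b + 1) := by
    intro b
    rw [hJ, ← heS, ← heS, he0]; ring
  have S0' : ∀ a, J (e a) (e 0) = e (a + 1) := by
    intro b
    rw [hJ, ← heS, ← heS, he0]; ring
  have S : ∀ n a b : ℕ, a + b = n → J (e a) (e b) = e (a + b + 1) := by
    intro n
    induction n using Nat.strong_induction_on with
    | _ n ih =>
      intro a b hab
      rcases a with _ | a
      · rw [S0]; congr 1; omega
      rcases b with _ | b
      · rw [S0']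
      have h1 := P _ a (b + 1) rfl (ih _ (by omega) _ _ rfl)
      have h2 := P _ (a + 1) b rfl (ih _ (by omega) _ _ rfl)
      have h3 := P _ a b rfl (ih _ (by omega) _ _ rfl)
      have h4 := ih (a + b) (by omega) a b rfl
      have h5 := P _ 0 (a + b + 1) rfl (by rw [S0]; congr 1; omega)
      rw [hJ, ← heS, ← heS] at h4 ⊢
      rw [show a + (b + 1) + 2 = a + b + 3 by omega] at h1
      rw [show a + 1 + b + 2 = a + b + 3 by omega] at h2
      rw [show 0 + (a + b + 1) + 2 = a + b + 3 by omega, he0] at h5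
      rw [show a + 1 + (b + 1) + 1 = a + b + 3 by omega]
      simp only [Nat.add_assoc, Nat.reduceAdd, Nat.zero_add] at *
      linear_combination h1 + h2 - e 1 * h3 - h5 + D * h4
  have Q : ∀ a b : ℕ, e (a + 1) * e (b + 1) = e (a + b + 2) + D * e a * e b :=
    fun a b => P _ a b rfl (S _ a b rfl)
  intro q q0 hq a b ha hb
  have q' : ∀ n, q (n + 1) = e (n + 1) - e n := fun n => by
    rw [hq (n + 1) (by omega)]; rfl
  obtain ⟨a, rfl⟩ := Nat.exists_eq_add_of_le' ha
  obtain ⟨b, rfl⟩ := Nat.exists_eq_add_of_le' hb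
  rw [show a + 1 + (b + 1) = a + b + 1 + 1 by omega]
  simp only [Nat.add_sub_cancel, q']
  have h := Q a b
  rcases a with _ | a <;> rcases b with _ | b
  · simp only [q0, he0, Nat.zero_add, Nat.reduceAdd] at *
    linear_combination h
  · have h1 := Q 0 b
    simp only [q0, q', he0, Nat.zero_add, Nat.add_assoc, Nat.reduceAdd] at *
    linear_combination h - h1
  · have h1 := Q a 0
    simp only [q0, q', he0, Nat.zero_add, Nat.add_zero, Nat.add_assoc, Nat.reduceAdd] at *
    linear_combination h - h1
  · have h1 := Q a b
    have h2 := Q (a + 1) b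
    have h3 := Q a (b + 1)
    rw [show a + 1 + b + 2 = a + b + 3 by omega] at h2
    rw [show a + (b + 1) + 2 = a + b + 3 by omega] at h3
    rw [show a + 1 + (b + 1) + 2 = a + b + 4 by omega] at h
    rw [show a + 1 + (b + 1) = a + b + 2 by omega]
    simp only [q', Nat.add_assoc, Nat.reduceAdd] at *
    linear_combination h - h2 - h3 + h1
end

section
/- Let M be an additive commutative group and let C_0, C_1 : M → M be additive endomorphisms such that C_1 ∘ C_0^a ∘ C_1 = 0 for every natural number a ≥ 0 (where C_0^a is the a-fold iterate). Then for every natural number n, (C_0 + C_1)^n = C_0^n + Σ_{i+j = n−1} C_0^i ∘ C_1 ∘ C_0^j, the sum being over all pairs of natural numbers (i, j) with i + j = n − 1 (and the sum being empty when n = 0). In particular, in the expansion of (C_0 + C_1)^n every term involving C_1 at least twice vanishes. -/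
theorem stmt_10 (M : Type*) [AddCommGroup M]
    (C₀ C₁ : AddMonoid.End M)
    (h : ∀ a : ℕ, C₁ * C₀ ^ a * C₁ = 0) :
    ∀ n : ℕ,
      (C₀ + C₁) ^ n
        = C₀ ^ n + ∑ i ∈ Finset.range n, C₀ ^ i * C₁ * C₀ ^ (n - 1 - i) := by
  intro n
  induction n with
  | zero => simp
  | succ n ih =>
    have h1 : C₁ * ∑ i ∈ Finset.range n, C₀ ^ i * C₁ * C₀ ^ (n - 1 - i) = 0 := by
      rw [Finset.mul_sum]
      refine Finset.sum_eq_zero fun i _ => ?_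
      rw [← mul_assoc, ← mul_assoc, h, zero_mul]
    have h2 : C₀ * ∑ i ∈ Finset.range n, C₀ ^ i * C₁ * C₀ ^ (n - 1 - i)
        = ∑ i ∈ Finset.range n, C₀ ^ (i + 1) * C₁ * C₀ ^ (n + 1 - 1 - (i + 1)) := by
      rw [Finset.mul_sum]
      refine Finset.sum_congr rfl fun i _ => ?_
      have e : n + 1 - 1 - (i + 1) = n - 1 - i := by omega
      rw [e, pow_succ' C₀ i]
      simp only [mul_assoc]
    rw [pow_succ', ih, Finset.sum_range_succ', ← h2, add_mul, mul_add, mul_add, h1, pow_succ' C₀ n]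
    simp only [pow_zero, one_mul, Nat.add_sub_cancel, Nat.sub_zero, add_zero]
    abel
end

section
/- For all lists L, M of pairs of natural numbers, every list N with nonzero coefficient in the merge product L * M has length between max(length L, length M) and (length L) + (length M) inclusive. -/
/-- The mix operator on pairs of natural numbers: `(a,b) # (c,d) = (a+c+1, b+d+1)`. -/
def mixPair (A B : ℕ × ℕ) : ℕ × ℕ :=
  (A.1 + B.1 + 1, A.2 + B.2 + 1)

/-- Prepend the pair `A` to every list appearing in a formal ℕ-linear combination of
lists of pairs of natural numbers (extended linearly). -/
noncomputable def prependPair (A : ℕ × ℕ) (s : List (ℕ × ℕ) →₀ ℕ) :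
    List (ℕ × ℕ) →₀ ℕ :=
  Finsupp.mapDomain (List.cons A) s

/-- The merge product of two lists of pairs of natural numbers, a formal ℕ-linear
combination of lists of pairs of natural numbers. -/
noncomputable def mergeProd : List (ℕ × ℕ) → List (ℕ × ℕ) → (List (ℕ × ℕ) →₀ ℕ)
  | [], M => Finsupp.single M 1
  | L, [] => Finsupp.single L 1
  | A :: L, B :: M =>
      prependPair A (mergeProd L (B :: M)) + prependPair B (mergeProd (A :: L) M)
        + prependPair (mixPair A B) (mergeProd L M)
termination_by L M => L.length + M.length

theorem prependPair_ne_zero_aux (A : ℕ × ℕ) (s : List (ℕ × ℕ) →₀ ℕ) (N : List (ℕ × ℕ))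
    (h : prependPair A s N ≠ 0) : ∃ N', s N' ≠ 0 ∧ N = A :: N' := by
  classical
  have h1 : N ∈ (Finsupp.mapDomain (List.cons A) s).support := Finsupp.mem_support_iff.mpr h
  have h2 := Finsupp.mapDomain_support h1
  obtain ⟨N', hN, rfl⟩ := Finset.mem_image.mp h2
  exact ⟨N', Finsupp.mem_support_iff.mp hN, rfl⟩

theorem mergeProd_length_aux (n : ℕ) : ∀ (L M N : List (ℕ × ℕ)), L.length + M.length ≤ n →
    mergeProd L M N ≠ 0 →
    L.length ≤ N.length ∧ M.length ≤ N.length ∧ N.length ≤ L.length + M.length := by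
  induction n with
  | zero =>
    intro L M N hn h
    have hL : L = [] := List.length_eq_zero_iff.mp (by omega)
    subst hL
    rw [mergeProd] at h
    have hN : M = N := by
      by_contra hne
      exact h (Finsupp.single_eq_of_ne' hne)
    subst hN
    simp
  | succ n ih =>
    intro L M N hn h
    match L, M with
    | [], M =>
      rw [mergeProd] at h
      have hN : M = N := by
        by_contra hne
        exact h (Finsupp.single_eq_of_ne' hne)
      subst hN
      simp
    | A :: L, [] =>
      rw [mergeProd] at h
      · have hN : A :: L = N := by
          by_contra hne
          exact h (Finsupp.single_eq_of_ne' hne)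
        subst hN
        simp
      · simp
    | A :: L, B :: M =>
      rw [mergeProd, Finsupp.add_apply, Finsupp.add_apply] at h
      simp only [List.length_cons] at hn ⊢
      have h3 : prependPair A (mergeProd L (B :: M)) N ≠ 0 ∨
          prependPair B (mergeProd (A :: L) M) N ≠ 0 ∨
          prependPair (mixPair A B) (mergeProd L M) N ≠ 0 := by omega
      rcases h3 with h3 | h3 | h3 <;> obtain ⟨N', hN', rfl⟩ := prependPair_ne_zero_aux _ _ _ h3 <;>
        have := ih _ _ _ (by (try simp only [List.length_cons]); omega) hN' <;>
        simp only [List.length_cons] at this ⊢ <;> omega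

theorem stmt_13 (L M N : List (ℕ × ℕ)) (h : mergeProd L M N ≠ 0) :
    max L.length M.length ≤ N.length ∧ N.length ≤ L.length + M.length := by
  obtain ⟨h1, h2, h3⟩ := mergeProd_length_aux _ L M N le_rfl h
  exact ⟨max_le h1 h2, h3⟩
end

section
/- For lists L, M of pairs of natural numbers, the sum of all coefficients of the merge product L * M depends only on the pair (length L, length M): if L, L' have equal length and M, M' have equal length, then the total coefficient sum of L * M equals that of L' * M'. -/
theorem sum_add_aux (f g : List (ℕ × ℕ) →₀ ℕ) :
    (f + g).sum (fun _ c => c) = f.sum (fun _ c => c) + g.sum (fun _ c => c) :=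
  Finsupp.sum_add_index' (fun _ => rfl) (fun _ _ _ => rfl)

theorem sum_prepend_aux (A : ℕ × ℕ) (f : List (ℕ × ℕ) →₀ ℕ) :
    (prependPair A f).sum (fun _ c => c) = f.sum (fun _ c => c) :=
  Finsupp.sum_mapDomain_index (fun _ => rfl) (fun _ _ _ => rfl)

theorem mergeProd_sum_aux (n : ℕ) : ∀ L L' M M' : List (ℕ × ℕ),
    L.length + M.length ≤ n → L.length = L'.length → M.length = M'.length →
    (mergeProd L M).sum (fun _ c => c) = (mergeProd L' M').sum (fun _ c => c) := by
  induction n with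
  | zero =>
    intro L L' M M' hn hL hM
    have h1 : L = [] := List.length_eq_zero_iff.mp (by omega)
    have h2 : L' = [] := List.length_eq_zero_iff.mp (by omega)
    subst h1 h2
    simp [mergeProd]
  | succ n ih =>
    intro L L' M M' hn hL hM
    match L, L', M, M', hL, hM with
    | [], [], M, M', _, _ => simp [mergeProd]
    | A :: L, A' :: L', [], [], _, _ => simp [mergeProd]
    | A :: L, A' :: L', B :: M, B' :: M', hL, hM =>
      simp only [List.length_cons] at hn hL hM
      simp only [mergeProd, sum_add_aux, sum_prepend_aux]
      rw [ih L L' (B :: M) (B' :: M') (by simp only [List.length_cons]; omega) (by omega)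
          (by simp only [List.length_cons]; omega),
        ih (A :: L) (A' :: L') M M' (by simp only [List.length_cons]; omega)
          (by simp only [List.length_cons]; omega) (by omega),
        ih L L' M M' (by omega) (by omega) (by omega)]

theorem stmt_14 (L L' M M' : List (ℕ × ℕ))
    (hL : L.length = L'.length) (hM : M.length = M'.length) :
    (mergeProd L M).sum (fun _ c => c) = (mergeProd L' M').sum (fun _ c => c) := by
  exact mergeProd_sum_aux _ L L' M M' le_rfl hL hM
end
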